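/- Let A be an n×n real matrix with p distinct (complex) eigenvalues λ_1,…,λ_p, geometric multiplicities k_i, left eigenbases X_i, and maximum geometric multiplicity k_max, and let l ≥ k_max. Then the l-MSCP optimum of A equals the MACP optimum of A if and only if there exists a collection {h_1,…,h_p} with h_i ∈ H_i for each i, such that ⋃_{i=1}^p h_i is an optimal solution to the MACP (i.e., (A, I_{⋃ h_i}) is controllable and |⋃ h_i| equals the MACP optimum), and the auxiliary graph G(h_1,…,h_p) admits a proper vertex coloring with at most l colors. -/

import Mathlib

open Matrix

noncomputable section

/-- The controllability matrix `[B, AB, A²B, …, A^{n-1}B]`, as an `n × (n·l)` matrix. -/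
def ctrbMat {R : Type} [CommRing R] {n l : ℕ} (A : Matrix (Fin n) (Fin n) R)
    (B : Matrix (Fin n) (Fin l) R) : Matrix (Fin n) (Fin n × Fin l) R :=
  Matrix.of fun i jk => (A ^ (jk.1 : ℕ) * B) i jk.2

/-- `(A, B)` is controllable iff the controllability matrix has rank `n`. -/
def Controllable {R : Type} [CommRing R] {n l : ℕ} (A : Matrix (Fin n) (Fin n) R)
    (B : Matrix (Fin n) (Fin l) R) : Prop :=
  (ctrbMat A B).rank = n

/-- The columns of a matrix, as vectors. -/
def matCols {R : Type} [CommRing R] {n k : ℕ} (X : Matrix (Fin n) (Fin k) R) :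
    Fin k → (Fin n → R) := fun j i => X i j

/-- `X` is an `n × k` matrix whose columns are a basis of the λ-eigenspace of `Aᵀ`
(equivalently, its columns are `k` linearly independent left eigenvectors of `A`
for `μ`, spanning the whole left eigenspace; in particular `k` is the geometric
multiplicity of `μ`). -/
def IsLeftEigenbasis {n k : ℕ} (A : Matrix (Fin n) (Fin n) ℂ) (μ : ℂ)
    (X : Matrix (Fin n) (Fin k) ℂ) : Prop :=
  LinearIndependent ℂ (matCols X) ∧
  (∀ j, A.transpose.mulVec (matCols X j) = μ • matCols X j) ∧
  (∀ v : Fin n → ℂ, A.transpose.mulVec v = μ • v →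
      v ∈ Submodule.span ℂ (Set.range (matCols X)))

/-- The submatrix of `M` consisting of the columns indexed by `S`. -/
def colSub {R : Type} [CommRing R] {m n : ℕ} (M : Matrix (Fin m) (Fin n) R)
    (S : Finset (Fin n)) : Matrix (Fin m) {x // x ∈ S} R :=
  M.submatrix id (fun j => (j : Fin n))

/-- `H = {J ⊆ {1,…,n} : |J| = k and the k×k submatrix of Xᵀ formed by the columns
indexed by J is invertible}` (invertibility of the square submatrix is expressed
as full rank `k`). -/
def Hset {n k : ℕ} (X : Matrix (Fin n) (Fin k) ℂ) : Set (Finset (Fin n)) :=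
  {J | J.card = k ∧ (colSub X.transpose J).rank = k}

/-- The diagonal 0/1 matrix `I_S` selecting the states in `S`. -/
def diagSel {n : ℕ} (S : Finset (Fin n)) : Matrix (Fin n) (Fin n) ℝ :=
  Matrix.diagonal (fun j => if j ∈ S then (1 : ℝ) else 0)

/-- `‖B‖₀`, the number of nonzero entries of `B`. -/
def sparsity {n l : ℕ} (B : Matrix (Fin n) (Fin l) ℝ) : ℕ :=
  (Finset.univ.filter fun jc : Fin n × Fin l => B jc.1 jc.2 ≠ 0).card

/-- The MACP optimum: the minimal cardinality of a set `S` of actuated states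
such that `(A, I_S)` is controllable. -/
def MACPopt {n : ℕ} (A : Matrix (Fin n) (Fin n) ℝ) : ℕ :=
  sInf {m | ∃ S : Finset (Fin n), Controllable A (diagSel S) ∧ S.card = m}

/-- The `l`-MSCP optimum: the minimal number of nonzero entries of an `n × l`
real matrix `B` such that `(A, B)` is controllable. -/
def MSCPopt {n : ℕ} (A : Matrix (Fin n) (Fin n) ℝ) (l : ℕ) : ℕ :=
  sInf {m | ∃ B : Matrix (Fin n) (Fin l) ℝ, Controllable A B ∧ sparsity B = m}

/-- The left kernel of `M` is trivial. -/
def LeftKernelTrivial {K m n : Type*} [Field K] [Fintype m] (M : Matrix m n K) : Prop :=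
  ∀ w : m → K, w ᵥ* M = 0 → w = 0

theorem rank_eq_card_iff_leftKernelTrivial {K m n : Type*} [Field K] [Fintype m] [Fintype n]
    (M : Matrix m n K) : M.rank = Fintype.card m ↔ LeftKernelTrivial M := by
  have h : LeftKernelTrivial M ↔ Function.Injective M.vecMul := by
    refine ⟨fun h a b hab => ?_, fun h w hw => h (by simpa using hw)⟩
    refine sub_eq_zero.1 (h _ ?_)
    rw [sub_vecMul]
    exact sub_eq_zero.2 hab
  rw [h, vecMul_injective_iff, linearIndependent_iff_card_eq_finrank_span,
    rank_eq_finrank_span_row]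
  exact eq_comm

theorem LeftKernelTrivial.of_det_submatrix_ne_zero {K m n : Type*} [Field K] [Fintype m]
    [DecidableEq m] {M : Matrix m n K} {f : m → n} (h : (M.submatrix id f).det ≠ 0) :
    LeftKernelTrivial M := fun _ hw =>
  eq_zero_of_vecMul_eq_zero h (funext fun j => congrFun hw (f j))

theorem LeftKernelTrivial.exists_det_submatrix_ne_zero {K n : Type*} [Field K] [Fintype n]
    {k : ℕ} {M : Matrix (Fin k) n K} (h : LeftKernelTrivial M) :
    ∃ f : Fin k → n, (M.submatrix id f).det ≠ 0 := by
  have hr := (rank_eq_card_iff_leftKernelTrivial M).2 h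
  rw [rank_eq_finrank_span_cols, Fintype.card_fin] at hr
  obtain ⟨g, hg, -, hli⟩ := Submodule.exists_fun_fin_finrank_span_eq K (Set.range M.col)
  revert g
  rw [hr]
  intro g hg hli
  choose f hf using hg
  refine ⟨f, ?_⟩
  have : (M.submatrix id f).col = g := by
    ext j i
    exact congrFun (hf j) i
  rw [← this, linearIndependent_cols_iff_isUnit, isUnit_iff_isUnit_det] at hli
  exact hli.ne_zero

theorem mem_Hset_iff {n k : ℕ} (X : Matrix (Fin n) (Fin k) ℂ) (J : Finset (Fin n)) :
    J ∈ Hset X ↔ ∃ r : Fin k → Fin n, Function.Injective r ∧ Finset.univ.image r = J ∧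
      (Xᵀ.submatrix id r).det ≠ 0 := by
  have hrank : (colSub Xᵀ J).rank = k ↔ LeftKernelTrivial (colSub Xᵀ J) := by
    simpa using rank_eq_card_iff_leftKernelTrivial (colSub Xᵀ J)
  constructor
  · rintro ⟨hc, hJ⟩
    obtain ⟨f, hf⟩ := (hrank.1 hJ).exists_det_submatrix_ne_zero
    have hinj : Function.Injective fun t => (f t : Fin n) := by
      intro a b hab
      by_contra hne
      exact hf (det_zero_of_column_eq hne fun i => congrArg (fun j => Xᵀ i j) hab)
    refine ⟨_, hinj, Finset.eq_of_subset_of_card_le ?_ ?_, hf⟩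
    · intro j hj
      obtain ⟨t, -, rfl⟩ := Finset.mem_image.1 hj
      exact (f t).2
    · rw [Finset.card_image_of_injective _ hinj]
      simp [hc]
  · rintro ⟨r, hr, rfl, hdet⟩
    refine ⟨by simp [Finset.card_image_of_injective _ hr], hrank.2 ?_⟩
    exact LeftKernelTrivial.of_det_submatrix_ne_zero
      (f := fun t => ⟨r t, Finset.mem_image_of_mem r (Finset.mem_univ t)⟩) hdet

theorem vecMul_ctrbMat_eq_zero_iff {R : Type} [CommRing R] {n l : ℕ}
    (A : Matrix (Fin n) (Fin n) R) (B : Matrix (Fin n) (Fin l) R) (v : Fin n → R) :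
    v ᵥ* ctrbMat A B = 0 ↔ ∀ j : Fin n, v ᵥ* (A ^ (j : ℕ) * B) = 0 :=
  ⟨fun h j => funext fun c => congrFun h (j, c), fun h => funext fun jc => congrFun (h jc.1) jc.2⟩

theorem controllable_iff_leftKernelTrivial {K : Type} [Field K] {n l : ℕ}
    (A : Matrix (Fin n) (Fin n) K) (B : Matrix (Fin n) (Fin l) K) :
    Controllable A B ↔ LeftKernelTrivial (ctrbMat A B) := by
  simpa [Controllable] using rank_eq_card_iff_leftKernelTrivial (ctrbMat A B)

theorem leftKernelTrivial_map_ofReal_iff {m n : Type*} [Fintype m] (M : Matrix m n ℝ) :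
    LeftKernelTrivial (M.map Complex.ofReal) ↔ LeftKernelTrivial M := by
  constructor
  · intro h w hw
    have := h (fun i => (w i : ℂ)) (by
      ext j
      have := congrFun hw j
      simp only [vecMul, dotProduct, Pi.zero_apply, map_apply] at this ⊢
      exact_mod_cast this)
    ext i
    exact Complex.ofReal_eq_zero.1 (congrFun this i)
  · intro h w hw
    have hre := h (fun i => (w i).re) (by
      ext j
      have := congrArg Complex.re (congrFun hw j)
      simpa [vecMul, dotProduct] using this)
    have him := h (fun i => (w i).im) (by
      ext j
      have := congrArg Complex.im (congrFun hw j)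
      simpa [vecMul, dotProduct] using this)
    ext i
    exact Complex.ext (congrFun hre i) (congrFun him i)

theorem ctrbMat_map_ofReal {n l : ℕ} (A : Matrix (Fin n) (Fin n) ℝ)
    (B : Matrix (Fin n) (Fin l) ℝ) :
    ctrbMat (A.map Complex.ofReal) (B.map Complex.ofReal)
      = (ctrbMat A B).map Complex.ofReal := by
  ext i jk
  have h := congrFun₂ (Matrix.map_mul (L := A ^ (jk.1 : ℕ)) (M := B) (f := Complex.ofRealHom))
    i jk.2
  rw [Matrix.map_pow] at h
  exact h.symm

theorem controllable_map_ofReal_iff {n l : ℕ} (A : Matrix (Fin n) (Fin n) ℝ)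
    (B : Matrix (Fin n) (Fin l) ℝ) :
    Controllable (A.map Complex.ofReal) (B.map Complex.ofReal) ↔ Controllable A B := by
  rw [controllable_iff_leftKernelTrivial, controllable_iff_leftKernelTrivial, ctrbMat_map_ofReal,
    leftKernelTrivial_map_ofReal_iff]

theorem vecMul_pow_mul_eq_zero {K : Type*} [Field K] {n l : ℕ} {A : Matrix (Fin n) (Fin n) K}
    {B : Matrix (Fin n) (Fin l) K} {v : Fin n → K}
    (h : ∀ j : Fin n, v ᵥ* (A ^ (j : ℕ) * B) = 0) (m : ℕ) : v ᵥ* (A ^ m * B) = 0 := by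
  rcases Nat.eq_zero_or_pos n with rfl | hn
  · rw [Subsingleton.elim v 0, zero_vecMul]
  have hdeg : (Polynomial.X ^ m %ₘ A.charpoly).natDegree < n := by
    have := Polynomial.natDegree_modByMonic_lt (Polynomial.X ^ m : Polynomial K)
      A.charpoly_monic (fun h1 => by
        have := A.charpoly_natDegree_eq_dim
        simp [h1] at this
        omega)
    simpa using this
  rw [pow_eq_aeval_mod_charpoly, Polynomial.aeval_eq_sum_range' hdeg, Matrix.sum_mul,
    vecMul_sum]
  refine Finset.sum_eq_zero fun j hj => ?_
  rw [Matrix.smul_mul, vecMul_smul, h ⟨j, Finset.mem_range.1 hj⟩, smul_zero]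

/-- The Popov–Belevitch–Hautus eigenvector test. -/
theorem controllable_iff_eigenvector {K : Type} [Field K] [IsAlgClosed K] {n l : ℕ}
    (A : Matrix (Fin n) (Fin n) K) (B : Matrix (Fin n) (Fin l) K) :
    Controllable A B ↔
      ∀ (c : K) (v : Fin n → K), v ᵥ* A = c • v → v ᵥ* B = 0 → v = 0 := by
  rw [controllable_iff_leftKernelTrivial]
  constructor
  · intro h c v hA hB
    refine h v ((vecMul_ctrbMat_eq_zero_iff A B v).2 fun j => ?_)
    have hpow : ∀ m : ℕ, v ᵥ* A ^ m = c ^ m • v := by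
      intro m
      induction m with
      | zero => simp
      | succ m ih => rw [pow_succ, ← vecMul_vecMul, ih, smul_vecMul, hA, smul_smul, pow_succ]
    rw [← vecMul_vecMul, hpow, smul_vecMul, hB, smul_zero]
  · intro h
    let W : Submodule K (Fin n → K) := LinearMap.ker (ctrbMat A B).vecMulLinear
    have hW : ∀ v, v ∈ W ↔ ∀ j : Fin n, v ᵥ* (A ^ (j : ℕ) * B) = 0 :=
      vecMul_ctrbMat_eq_zero_iff A B
    have hinv : ∀ v ∈ W, A.vecMulLinear v ∈ W := fun v hv => (hW _).2 fun j => by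
      rw [vecMulLinear_apply, vecMul_vecMul, ← Matrix.mul_assoc, ← pow_succ']
      exact vecMul_pow_mul_eq_zero ((hW v).1 hv) _
    intro w hw
    by_contra hne
    have : Nontrivial W := ⟨⟨⟨w, hw⟩, 0, fun h0 => hne (congrArg Subtype.val h0)⟩⟩
    obtain ⟨c, hc⟩ := Module.End.exists_eigenvalue (A.vecMulLinear.restrict hinv)
    obtain ⟨v, hv⟩ := hc.exists_hasEigenvector
    refine hv.2 (Subtype.ext (h c v (congrArg Subtype.val hv.apply_eq_smul) ?_))
    simpa using vecMul_pow_mul_eq_zero ((hW v).1 v.2) 0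

theorem controllable_iff_eigenbases {n l p : ℕ} {A : Matrix (Fin n) (Fin n) ℝ} {μ : Fin p → ℂ}
    (hspec : spectrum ℂ (A.map Complex.ofReal) = Set.range μ)
    {k : Fin p → ℕ} {X : ∀ i, Matrix (Fin n) (Fin (k i)) ℂ}
    (hX : ∀ i, IsLeftEigenbasis (A.map Complex.ofReal) (μ i) (X i))
    (B : Matrix (Fin n) (Fin l) ℝ) :
    Controllable A B ↔ ∀ i, LeftKernelTrivial ((X i)ᵀ * B.map Complex.ofReal) := by
  rw [← controllable_map_ofReal_iff, controllable_iff_eigenvector]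
  have hcomb : ∀ i (w : Fin (k i) → ℂ), w ᵥ* (X i)ᵀ = ∑ j, w j • matCols (X i) j := by
    intro i w
    ext a
    simp [vecMul, dotProduct, matCols]
  constructor
  · intro h i w hw
    rw [← vecMul_vecMul] at hw
    have h0 := h (μ i) _ (by
      rw [hcomb, ← mulVec_transpose, mulVec_sum, Finset.smul_sum]
      refine Finset.sum_congr rfl fun j _ => ?_
      rw [mulVec_smul, (hX i).2.1 j, smul_comm]) hw
    rw [hcomb] at h0
    exact funext (Fintype.linearIndependent_iff.1 (hX i).1 w h0)
  · intro h c v hA hB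
    by_contra hne
    rw [← mulVec_transpose] at hA
    have hc : c ∈ spectrum ℂ (A.map Complex.ofReal) := by
      have hT : c ∈ spectrum ℂ (A.map Complex.ofReal)ᵀ := by
        rw [← spectrum_toLin']
        exact (Module.End.hasEigenvalue_of_hasEigenvector (x := v)
          ⟨Module.End.mem_eigenspace_iff.2 hA, hne⟩).mem_spectrum
      rwa [mem_spectrum_iff_isRoot_charpoly, charpoly_transpose,
        ← mem_spectrum_iff_isRoot_charpoly] at hT
    rw [hspec] at hc
    obtain ⟨i, rfl⟩ := hc
    obtain ⟨w, rfl⟩ := (Submodule.mem_span_range_iff_exists_fun ℂ).1 ((hX i).2.2 v hA)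
    rw [← hcomb, vecMul_vecMul] at hB
    exact hne (by simp [h i w hB])

theorem leftKernelTrivial_mul_diagSel {n l k : ℕ} {Y : Matrix (Fin k) (Fin n) ℂ}
    {B : Matrix (Fin n) (Fin l) ℝ} {S : Finset (Fin n)} (hS : ∀ j c, B j c ≠ 0 → j ∈ S)
    (h : LeftKernelTrivial (Y * B.map Complex.ofReal)) :
    LeftKernelTrivial (Y * (diagSel S).map Complex.ofReal) := by
  intro w hw
  refine h w ?_
  rw [← vecMul_vecMul] at hw ⊢
  have hY : ∀ j ∈ S, (w ᵥ* Y) j = 0 := fun j hj => by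
    have := congrFun hw j
    rw [diagSel, diagonal_map Complex.ofReal_zero, vecMul_diagonal] at this
    simpa [hj] using this
  ext c
  rw [vecMul, dotProduct]
  refine Finset.sum_eq_zero fun j _ => ?_
  by_cases hj : j ∈ S
  · rw [hY j hj, zero_mul]
  · have : B j c = 0 := by_contra fun hB => hj (hS j c hB)
    simp [this]

theorem leftKernelTrivial_mul_diagSel_of_det {n k : ℕ} {Y : Matrix (Fin k) (Fin n) ℂ}
    {r : Fin k → Fin n} (hdet : (Y.submatrix id r).det ≠ 0) {S : Finset (Fin n)}
    (hS : ∀ t, r t ∈ S) : LeftKernelTrivial (Y * (diagSel S).map Complex.ofReal) := by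
  refine LeftKernelTrivial.of_det_submatrix_ne_zero (f := r) ?_
  convert hdet using 1
  congr 1
  ext a t
  rw [submatrix_apply, diagSel, diagonal_map Complex.ofReal_zero, mul_diagonal]
  simp [hS t]

/-- If the `f`-columns of `Y * B` are independent, so are some columns of `Y`, one from the
support of each of the `f`-columns of `B`. -/
theorem exists_det_submatrix_ne_zero_of_mul {K : Type*} [Field K] {n l k : ℕ}
    {Y : Matrix (Fin k) (Fin n) K} {B : Matrix (Fin n) (Fin l) K} {f : Fin k → Fin l}
    (h : ((Y * B).submatrix id f).det ≠ 0) :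
    ∃ r : Fin k → Fin n, (∀ t, B (r t) (f t) ≠ 0) ∧ (Y.submatrix id r).det ≠ 0 := by
  have hsum : ((Y * B).submatrix id f).det =
      ∑ r : Fin k → Fin n, (∏ t, B (r t) (f t)) * (Y.submatrix id r).det := by
    have hT : ((Y * B).submatrix id f)ᵀ = fun t => ∑ j, B j (f t) • Yᵀ j := by
      ext t a
      simp [mul_apply, mul_comm]
    rw [← det_transpose, hT]
    refine (MultilinearMap.map_sum detRowAlternating.toMultilinearMap _).trans ?_
    refine Finset.sum_congr rfl fun r _ => ?_
    rw [← det_transpose (Y.submatrix id r), ← smul_eq_mul]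
    exact MultilinearMap.map_smul_univ _ _ _
  rw [hsum] at h
  obtain ⟨r, -, hr⟩ := Finset.exists_ne_zero_of_sum_ne_zero h
  exact ⟨r, fun t => Finset.prod_ne_zero_iff.1 (left_ne_zero_of_mul hr) t (Finset.mem_univ t),
    right_ne_zero_of_mul hr⟩

/-- The indices of the nonzero rows of `B`. -/
def rowSupport {n l : ℕ} (B : Matrix (Fin n) (Fin l) ℝ) : Finset (Fin n) :=
  (Finset.univ.filter fun jc : Fin n × Fin l => B jc.1 jc.2 ≠ 0).image Prod.fst

theorem mem_rowSupport {n l : ℕ} {B : Matrix (Fin n) (Fin l) ℝ} {j : Fin n} {c : Fin l}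
    (h : B j c ≠ 0) : j ∈ rowSupport B :=
  Finset.mem_image.2 ⟨(j, c), by simpa using h, rfl⟩

theorem card_rowSupport_le {n l : ℕ} (B : Matrix (Fin n) (Fin l) ℝ) :
    (rowSupport B).card ≤ sparsity B :=
  Finset.card_image_le

theorem eq_of_sparsity_le_card_rowSupport {n l : ℕ} {B : Matrix (Fin n) (Fin l) ℝ}
    (h : sparsity B ≤ (rowSupport B).card) {j : Fin n} {c c' : Fin l} (hc : B j c ≠ 0)
    (hc' : B j c' ≠ 0) : c = c' :=
  congrArg Prod.snd (Finset.card_image_iff.1 ((card_rowSupport_le B).antisymm h)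
    (show (j, c) ∈ _ by simpa using hc) (show (j, c') ∈ _ by simpa using hc') rfl)

theorem MACPopt_le {n : ℕ} {A : Matrix (Fin n) (Fin n) ℝ} {S : Finset (Fin n)}
    (h : Controllable A (diagSel S)) : MACPopt A ≤ S.card :=
  Nat.sInf_le ⟨S, h, rfl⟩

theorem MSCPopt_le {n l : ℕ} {A : Matrix (Fin n) (Fin n) ℝ} {B : Matrix (Fin n) (Fin l) ℝ}
    (h : Controllable A B) : MSCPopt A l ≤ sparsity B :=
  Nat.sInf_le ⟨B, h, rfl⟩

theorem exists_sparsity_eq_MSCPopt {n l : ℕ} {A : Matrix (Fin n) (Fin n) ℝ}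
    {B : Matrix (Fin n) (Fin l) ℝ} (h : Controllable A B) :
    ∃ B' : Matrix (Fin n) (Fin l) ℝ, Controllable A B' ∧ sparsity B' = MSCPopt A l :=
  Nat.sInf_mem (s := {m | ∃ B : Matrix (Fin n) (Fin l) ℝ, Controllable A B ∧ sparsity B = m})
    ⟨_, B, h, rfl⟩

theorem controllable_diagSel_univ {n : ℕ} (A : Matrix (Fin n) (Fin n) ℝ) :
    Controllable A (diagSel Finset.univ) := by
  have h1 : diagSel (Finset.univ : Finset (Fin n)) = 1 := by simp [diagSel]
  rw [controllable_iff_leftKernelTrivial]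
  intro w hw
  rcases Nat.eq_zero_or_pos n with rfl | hn
  · exact Subsingleton.elim _ _
  simpa [h1] using (vecMul_ctrbMat_eq_zero_iff _ _ _).1 hw ⟨0, hn⟩

theorem exists_card_eq_MACPopt {n : ℕ} (A : Matrix (Fin n) (Fin n) ℝ) :
    ∃ S : Finset (Fin n), Controllable A (diagSel S) ∧ S.card = MACPopt A :=
  Nat.sInf_mem (s := {m | ∃ S : Finset (Fin n), Controllable A (diagSel S) ∧ S.card = m})
    ⟨_, Finset.univ, controllable_diagSel_univ A, rfl⟩

theorem exists_controllable_of_MSCPopt_eq_MACPopt {n l : ℕ} {A : Matrix (Fin n) (Fin n) ℝ}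
    (h : MSCPopt A l = MACPopt A) :
    ∃ B : Matrix (Fin n) (Fin l) ℝ, Controllable A B ∧ sparsity B = MACPopt A := by
  rw [← h]
  by_cases hB : ∃ B : Matrix (Fin n) (Fin l) ℝ, Controllable A B
  · exact exists_sparsity_eq_MSCPopt hB.choose_spec
  · exfalso
    push Not at hB
    have h0 : MSCPopt A l = 0 := by
      simp [MSCPopt, hB]
    obtain ⟨S, hS, hcard⟩ := exists_card_eq_MACPopt A
    rw [← h, h0, Finset.card_eq_zero] at hcard
    rw [controllable_iff_leftKernelTrivial] at hS
    refine hB 0 ((controllable_iff_leftKernelTrivial _ _).2 fun w _ => hS w ?_)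
    rw [vecMul_ctrbMat_eq_zero_iff]
    simp [hcard, diagSel]

/-- The matrix with entries `b j` at the positions `(j, c j)`, `j ∈ U`, and zeros elsewhere. -/
def coloredMat {R : Type*} [Zero R] {n : ℕ} (l : ℕ) (U : Finset (Fin n)) (c : Fin n → ℕ)
    (b : Fin n → R) : Matrix (Fin n) (Fin l) R :=
  of fun j a => if j ∈ U ∧ c j = a then b j else 0

theorem coloredMat_map {R R' : Type*} [Zero R] [Zero R'] {n l : ℕ} (U : Finset (Fin n))
    (c : Fin n → ℕ) (b : Fin n → R) {φ : R → R'} (hφ : φ 0 = 0) :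
    (coloredMat l U c b).map φ = coloredMat l U c (fun j => φ (b j)) := by
  ext j a
  simp only [coloredMat, map_apply, of_apply]
  split_ifs
  · rfl
  · exact hφ

theorem sparsity_coloredMat_le {n l : ℕ} (U : Finset (Fin n)) (c : Fin n → ℕ) (b : Fin n → ℝ) :
    sparsity (coloredMat l U c b) ≤ U.card := by
  have hmem : ∀ j (a : Fin l), coloredMat l U c b j a ≠ 0 → j ∈ U ∧ c j = a := by
    intro j a h
    by_contra hn
    exact h (if_neg hn)
  refine Finset.card_le_card_of_injOn Prod.fst ?_ ?_
  · rintro ⟨j, a⟩ h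
    exact (hmem j a (by simpa using h)).1
  · rintro ⟨j, a⟩ h ⟨j', a'⟩ h' hj
    obtain rfl : j = j' := hj
    have h1 := (hmem j a (by simpa using h)).2
    have h2 := (hmem j a' (by simpa using h')).2
    rw [Prod.mk.injEq]
    exact ⟨rfl, Fin.ext (h1.symm.trans h2)⟩

theorem exists_real_eval_ne_zero {σ : Type*} {P : MvPolynomial σ ℂ} (hP : P ≠ 0) :
    ∃ b : σ → ℝ, MvPolynomial.eval (fun j => (b j : ℂ)) P ≠ 0 := by
  by_contra! h
  refine hP (MvPolynomial.funext_set (fun _ => Set.range Complex.ofReal)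
    (fun _ => Set.infinite_range_of_injective Complex.ofReal_injective) fun x hx => ?_)
  choose b hb using fun j => hx j (Set.mem_univ j)
  rw [← funext hb, h, map_zero]

/-- A matrix supported on the positions of a proper coloring, with generic nonzero entries,
meets all the rank conditions simultaneously. -/
theorem exists_coloredMat_leftKernelTrivial {n l p : ℕ} {k : Fin p → ℕ}
    (Y : ∀ i, Matrix (Fin (k i)) (Fin n) ℂ) (r : ∀ i, Fin (k i) → Fin n)
    (hdet : ∀ i, ((Y i).submatrix id (r i)).det ≠ 0) (U : Finset (Fin n))
    (hU : ∀ i t, r i t ∈ U) (c : Fin n → ℕ) (hc : ∀ j ∈ U, c j < l)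
    (hinj : ∀ i, Function.Injective fun t => c (r i t)) :
    ∃ b : Fin n → ℝ,
      ∀ i, LeftKernelTrivial (Y i * (coloredMat l U c b).map Complex.ofReal) := by
  classical
  let f : ∀ i, Fin (k i) → Fin l := fun i t => ⟨c (r i t), hc _ (hU i t)⟩
  let P : Fin p → MvPolynomial (Fin n) ℂ := fun i =>
    (((Y i).map (MvPolynomial.C : ℂ →+* MvPolynomial (Fin n) ℂ) *
      coloredMat l U c (MvPolynomial.X : Fin n → MvPolynomial (Fin n) ℂ)).submatrix id (f i)).det
  have heval : ∀ i (x : Fin n → ℂ), MvPolynomial.eval x (P i) =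
      ((Y i * coloredMat l U c x).submatrix id (f i)).det := by
    intro i x
    rw [RingHom.map_det, RingHom.mapMatrix_apply, ← submatrix_map, Matrix.map_mul,
      coloredMat_map _ _ _ (map_zero _), Matrix.map_map]
    simp [Function.comp_def]
  have hP : ∀ i, P i ≠ 0 := by
    intro i h0
    have h := heval i (fun j => if j ∈ Set.range (r i) then 1 else 0)
    rw [h0, map_zero] at h
    refine hdet i (h ▸ congrArg det ?_)
    ext a t
    rw [submatrix_apply, submatrix_apply, mul_apply, Finset.sum_eq_single (r i t)]
    · simp [coloredMat, hU, f]
    · intro j _ hj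
      have : ¬ ((j ∈ U ∧ c j = f i t) ∧ j ∈ Set.range (r i)) := by
        rintro ⟨⟨-, h2⟩, s, rfl⟩
        exact hj (congrArg (r i) (hinj i h2))
      simp only [coloredMat, of_apply]
      rw [← ite_and, if_neg this, mul_zero]
    · simp
  obtain ⟨b, hb⟩ := exists_real_eval_ne_zero
    (Finset.prod_ne_zero_iff.2 fun i (_ : i ∈ Finset.univ) => hP i)
  refine ⟨b, fun i => LeftKernelTrivial.of_det_submatrix_ne_zero (f := f i) ?_⟩
  rw [map_prod, Finset.prod_ne_zero_iff] at hb
  rw [coloredMat_map _ _ _ Complex.ofReal_zero, ← heval]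
  exact hb i (Finset.mem_univ i)

theorem statement_14 {n l p : ℕ} (A : Matrix (Fin n) (Fin n) ℝ)
    (μ : Fin p → ℂ) (hμ : Function.Injective μ)
    (hspec : spectrum ℂ (A.map Complex.ofReal) = Set.range μ)
    (k : Fin p → ℕ) (X : ∀ i, Matrix (Fin n) (Fin (k i)) ℂ)
    (hX : ∀ i, IsLeftEigenbasis (A.map Complex.ofReal) (μ i) (X i))
    (hl : ∀ i, k i ≤ l) :
    MSCPopt A l = MACPopt A ↔
      ∃ h : Fin p → Finset (Fin n),
        (∀ i, h i ∈ Hset (X i)) ∧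
        Controllable A (diagSel (Finset.univ.biUnion h)) ∧
        (Finset.univ.biUnion h).card = MACPopt A ∧
        ∃ c : Fin n → ℕ,
          (∀ j ∈ Finset.univ.biUnion h, c j < l) ∧
          ∀ j j', j ≠ j' → (∃ i, j ∈ h i ∧ j' ∈ h i) → c j ≠ c j' := by
  classical
  constructor
  · intro hopt
    obtain ⟨B, hB, hcard⟩ := exists_controllable_of_MSCPopt_eq_MACPopt hopt
    have hBX := (controllable_iff_eigenbases hspec hX B).1 hB
    have hS : Controllable A (diagSel (rowSupport B)) :=
      (controllable_iff_eigenbases hspec hX _).2 fun i =>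
        leftKernelTrivial_mul_diagSel (fun j c => mem_rowSupport) (hBX i)
    have huniq : ∀ {j c c'}, B j c ≠ 0 → B j c' ≠ 0 → c = c' :=
      eq_of_sparsity_le_card_rowSupport (hcard.trans_le (MACPopt_le hS))
    choose f hf using fun i => (hBX i).exists_det_submatrix_ne_zero
    choose r hrB hr using fun i => exists_det_submatrix_ne_zero_of_mul (hf i)
    replace hrB : ∀ i t, B (r i t) (f i t) ≠ 0 := fun i t h0 => hrB i t (by simp [h0])
    have hrinj : ∀ i, Function.Injective (r i) := fun i a b hab => by
      by_contra hne
      exact hr i (det_zero_of_column_eq hne fun s => congrArg (fun j => (X i)ᵀ s j) hab)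
    have hfinj : ∀ i, Function.Injective (f i) := fun i a b hab => by
      by_contra hne
      exact hf i (det_zero_of_column_eq hne fun s =>
        congrArg (fun j => ((X i)ᵀ * B.map Complex.ofReal) s j) hab)
    have hmem : ∀ i t, r i t ∈ Finset.univ.biUnion fun i => Finset.univ.image (r i) :=
      fun i t => Finset.mem_biUnion.2
        ⟨i, Finset.mem_univ i, Finset.mem_image_of_mem _ (Finset.mem_univ t)⟩
    have hctrl : Controllable A (diagSel (Finset.univ.biUnion fun i => Finset.univ.image (r i))) :=
      (controllable_iff_eigenbases hspec hX _).2 fun i =>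
        leftKernelTrivial_mul_diagSel_of_det (hr i) (hmem i)
    let c : Fin n → ℕ := fun j => if h : ∃ a, B j a ≠ 0 then (h.choose : ℕ) else 0
    have hcol : ∀ i t, c (r i t) = f i t := fun i t => by
      have h : ∃ a, B (r i t) a ≠ 0 := ⟨_, hrB i t⟩
      simp only [c, dif_pos h]
      rw [huniq h.choose_spec (hrB i t)]
    refine ⟨fun i => Finset.univ.image (r i),
      fun i => (mem_Hset_iff _ _).2 ⟨r i, hrinj i, rfl, hr i⟩, hctrl,
      le_antisymm ?_ (MACPopt_le hctrl), c, ?_, ?_⟩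
    · rw [← hcard]
      refine (Finset.card_le_card ?_).trans (card_rowSupport_le B)
      intro j hj
      simp only [Finset.mem_biUnion, Finset.mem_image, Finset.mem_univ, true_and] at hj
      obtain ⟨i, t, rfl⟩ := hj
      exact mem_rowSupport (hrB i t)
    · intro j hj
      simp only [Finset.mem_biUnion, Finset.mem_image, Finset.mem_univ, true_and] at hj
      obtain ⟨i, t, rfl⟩ := hj
      rw [hcol]
      exact (f i t).2
    · rintro j j' hne ⟨i, hj, hj'⟩ heq
      obtain ⟨t, -, rfl⟩ := Finset.mem_image.1 hj
      obtain ⟨t', -, rfl⟩ := Finset.mem_image.1 hj'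
      rw [hcol, hcol] at heq
      exact hne (congrArg (r i) (hfinj i (Fin.ext heq)))
  · rintro ⟨h, hH, -, hcard, c, hcl, hc⟩
    choose r hrinj hrh hdet using fun i => (mem_Hset_iff _ _).1 (hH i)
    have hrmem : ∀ i t, r i t ∈ h i := fun i t =>
      hrh i ▸ Finset.mem_image_of_mem _ (Finset.mem_univ t)
    obtain ⟨b, hb⟩ := exists_coloredMat_leftKernelTrivial (l := l) (fun i => (X i)ᵀ) r hdet
      (Finset.univ.biUnion h)
      (fun i t => Finset.mem_biUnion.2 ⟨i, Finset.mem_univ i, hrmem i t⟩) c hcl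
      (fun i t t' htt => by
        by_contra hne
        exact hc _ _ ((hrinj i).ne hne) ⟨i, hrmem i t, hrmem i t'⟩ htt)
    have hB := (controllable_iff_eigenbases hspec hX _).2 hb
    refine le_antisymm ?_ ?_
    · rw [← hcard]
      exact (MSCPopt_le hB).trans (sparsity_coloredMat_le _ _ _)
    · obtain ⟨B, hB, hBcard⟩ := exists_sparsity_eq_MSCPopt hB
      rw [← hBcard]
      refine (MACPopt_le ?_).trans (card_rowSupport_le B)
      exact (controllable_iff_eigenbases hspec hX _).2 fun i =>
        leftKernelTrivial_mul_diagSel (fun j c => mem_rowSupport)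
          ((controllable_iff_eigenbases hspec hX B).1 hB i)
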